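/- Let m > 0, C ≥ 0, and let f be a holomorphic function on the open rectangle R = {z ∈ ℂ : 0 < Re z < m, 0 < Im z < 1} such that the area with multiplicity of its image satisfies ∫∫_R ‖f′(z)‖² dA(z) ≤ C. Then there exists x ∈ (0, m) such that the length of the image of the vertical segment {x + iy : 0 < y < 1} satisfies ∫₀¹ ‖f′(x + iy)‖ dy ≤ √(C/m). -/

import Mathlib

open MeasureTheory Complex

/-- Length–area argument on a conformal rectangle: if `f` is holomorphic on the
open rectangle `(0,m) × (0,1)` and the area with multiplicity of its image is
at most `C`, then some vertical segment has image of length at most `√(C/m)`. -/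
theorem exists_short_vertical_segment {m C : ℝ} (hm : 0 < m) (hC : 0 ≤ C)
    (f : ℂ → ℂ)
    (hf : DifferentiableOn ℂ f (Set.Ioo 0 m ×ℂ Set.Ioo 0 1))
    (hint : IntegrableOn (fun z => ‖deriv f z‖ ^ 2) (Set.Ioo 0 m ×ℂ Set.Ioo 0 1))
    (harea : ∫ z in Set.Ioo 0 m ×ℂ Set.Ioo 0 1, ‖deriv f z‖ ^ 2 ≤ C) :
    ∃ x ∈ Set.Ioo (0:ℝ) m,
      ∫ y in (0:ℝ)..1, ‖deriv f (x + y * Complex.I)‖ ≤ Real.sqrt (C / m) := by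
  have hmp := Complex.volume_preserving_equiv_real_prod.symm
  have hme : MeasurableEmbedding Complex.measurableEquivRealProd.symm :=
    Complex.measurableEquivRealProd.symm.measurableEmbedding
  have hpre : Complex.measurableEquivRealProd.symm ⁻¹' (Set.Ioo 0 m ×ℂ Set.Ioo 0 1)
      = Set.Ioo (0:ℝ) m ×ˢ Set.Ioo (0:ℝ) 1 := by
    ext p
    simp [Complex.mem_reProdIm, Complex.measurableEquivRealProd_symm_apply]
  have hfun : ∀ p : ℝ × ℝ, Complex.measurableEquivRealProd.symm p = p.1 + p.2 * Complex.I := by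
    intro p
    apply Complex.ext <;> simp [Complex.measurableEquivRealProd_symm_apply]
  rw [← hmp.integrableOn_comp_preimage hme, hpre] at hint
  rw [← hmp.setIntegral_preimage_emb hme, hpre] at harea
  simp only [hfun, Function.comp_def] at hint harea
  set μ := (volume : Measure ℝ).restrict (Set.Ioo 0 m) with hμ
  set ν := (volume : Measure ℝ).restrict (Set.Ioo 0 1) with hν
  rw [IntegrableOn, Measure.volume_eq_prod, ← Measure.prod_restrict] at hint
  rw [Measure.volume_eq_prod, ← Measure.prod_restrict, integral_prod _ hint] at harea
  have hslice := hint.prod_right_ae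
  have hmem : ∀ᵐ x ∂μ, x ∈ Set.Ioo 0 m := ae_restrict_mem measurableSet_Ioo
  have hN := hmem.and hslice
  have hμ0 : μ ≠ 0 := by
    rw [hμ, Ne, Measure.restrict_eq_zero]
    simp [hm]
  have : IsProbabilityMeasure ν := ⟨by simp [hν]⟩
  obtain ⟨x, hxN, hx⟩ := exists_notMem_null_le_average hμ0 hint.integral_prod_left
    (ae_iff.mp hN)
  simp only [Set.mem_ofPred_eq, not_not] at hxN
  obtain ⟨hxm, hxi⟩ := hxN
  rw [← hν] at hxi
  refine ⟨x, hxm, ?_⟩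
  rw [intervalIntegral.integral_of_le zero_le_one, integral_Ioc_eq_integral_Ioo]
  change ∫ y, ‖deriv f (x + y * Complex.I)‖ ∂ν ≤ _
  have hmeas : Measurable (fun y : ℝ => ‖deriv f (x + y * Complex.I)‖) :=
    ((measurable_deriv f).comp (by fun_prop)).norm
  have hL2 : MemLp (fun y : ℝ => ‖deriv f (x + y * Complex.I)‖) 2 ν :=
    (memLp_two_iff_integrable_sq hmeas.aestronglyMeasurable).2 hxi
  have hi := hL2.integrable (by norm_num)
  apply Real.le_sqrt_of_sq_le
  set a := ∫ y, ‖deriv f (x + y * Complex.I)‖ ∂ν with ha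
  have h0 : 0 ≤ ∫ y, (‖deriv f (x + y * Complex.I)‖ - a) ^ 2 ∂ν :=
    integral_nonneg fun y => sq_nonneg _
  have h1 : ∫ y, (‖deriv f (x + y * Complex.I)‖ - a) ^ 2 ∂ν
      = (∫ y, ‖deriv f (x + y * Complex.I)‖ ^ 2 ∂ν) - a ^ 2 := by
    have : ∀ y : ℝ, (‖deriv f (x + y * Complex.I)‖ - a) ^ 2
      = ‖deriv f (x + y * Complex.I)‖ ^ 2 - (2 * a) * ‖deriv f (x + y * Complex.I)‖ + a ^ 2 :=
      fun y => by ring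
    simp_rw [this]
    have hs : Integrable (fun y : ℝ => ‖deriv f (x + y * Complex.I)‖ ^ 2
        - (2 * a) * ‖deriv f (x + y * Complex.I)‖) ν := hxi.sub (hi.const_mul _)
    rw [integral_add hs (integrable_const _),
      integral_sub hxi (hi.const_mul _), integral_const_mul, ← ha]
    simp
    ring
  have h2 : ∫ y, ‖deriv f (x + y * Complex.I)‖ ^ 2 ∂ν ≤ C / m := by
    refine hx.trans ?_
    rw [average_eq]
    have : μ.real Set.univ = m := by simp [hμ, hm.le]
    rw [this, smul_eq_mul, inv_mul_eq_div]
    gcongr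
  linarith
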